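/- For every real number t and all x, y ∈ H, scalar multiplication distributes over hyperaddition: t·(x ⊞ y) = (t·x) ⊞ (t·y) as subsets of H, where t·(x⊞y) := {t·z : z ∈ x⊞y}. In particular, for each t ∈ ℝ the map x ↦ t·x is an endomorphism of the additive hypermagma (H, ⊞). -/

import Mathlib

inductive Sgn : Type
  | pos | neg | lam
deriving DecidableEq

inductive H : Type
  | zero : H
  | elt (σ : Sgn) (a : ℝ) (ha : 0 < a) : H

noncomputable def hadd : H → H → Set H
  | H.zero, x => {x}
  | x, H.zero => {x}
  | H.elt Sgn.pos a _, H.elt Sgn.pos b _ =>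
      {H.elt Sgn.pos (a + b) (by linarith)}
  | H.elt Sgn.neg a _, H.elt Sgn.neg b _ =>
      {H.elt Sgn.neg (a + b) (by linarith)}
  | H.elt Sgn.pos a _, H.elt Sgn.neg b _ =>
      if h : b < a then {H.elt Sgn.pos (a - b) (by linarith)}
      else if h' : a = b then {H.zero}
      else {H.elt Sgn.neg (b - a)
        (by push_neg at h; exact sub_pos.mpr (lt_of_le_of_ne h h'))}
  | H.elt Sgn.neg b _, H.elt Sgn.pos a _ =>
      if h : b < a then {H.elt Sgn.pos (a - b) (by linarith)}
      else if h' : a = b then {H.zero}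
      else {H.elt Sgn.neg (b - a)
        (by push_neg at h; exact sub_pos.mpr (lt_of_le_of_ne h h'))}
  | H.elt Sgn.pos a _, H.elt Sgn.lam b _ => {H.elt Sgn.lam (a + b) (by linarith)}
  | H.elt Sgn.neg a _, H.elt Sgn.lam b _ => {H.elt Sgn.lam (a + b) (by linarith)}
  | H.elt Sgn.lam b _, H.elt Sgn.pos a _ => {H.elt Sgn.lam (a + b) (by linarith)}
  | H.elt Sgn.lam b _, H.elt Sgn.neg a _ => {H.elt Sgn.lam (a + b) (by linarith)}
  | H.elt Sgn.lam a _, H.elt Sgn.lam b _ =>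
      if h : a = b then {H.elt Sgn.lam (2 * a) (by linarith), H.zero}
      else {H.elt Sgn.lam (a + b) (by linarith),
            H.elt Sgn.pos |a - b| (abs_pos.mpr (sub_ne_zero.mpr h)),
            H.elt Sgn.neg |a - b| (abs_pos.mpr (sub_ne_zero.mpr h))}

/-- Left bracketing `(x ⊞ y) ⊞ z` of the triple hyper-sum. -/
noncomputable def haddL (x y z : H) : Set H := ⋃ u ∈ hadd x y, hadd u z

/-- Right bracketing `x ⊞ (y ⊞ z)` of the triple hyper-sum. -/
noncomputable def haddR (x y z : H) : Set H := ⋃ v ∈ hadd y z, hadd x v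

/-- The commutative sign operation `*` on `{+, −, Λ}`. -/
def smul : Sgn → Sgn → Sgn
  | Sgn.pos, τ => τ
  | σ, Sgn.pos => σ
  | Sgn.neg, Sgn.neg => Sgn.pos
  | Sgn.lam, _ => Sgn.lam
  | _, Sgn.lam => Sgn.lam

/-- Multiplication on `H`. -/
def hmul : H → H → H
  | H.zero, _ => H.zero
  | _, H.zero => H.zero
  | H.elt σ a ha, H.elt τ b hb => H.elt (smul σ τ) (a * b) (mul_pos ha hb)

/-- The real embedding `ι : ℝ → H`. -/
noncomputable def iemb (r : ℝ) : H :=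
  if h : 0 < r then H.elt Sgn.pos r h
  else if h' : r < 0 then H.elt Sgn.neg (-r) (by linarith)
  else H.zero

/-- Scalar multiplication by a real number `t` on `H`, via `t · x := ι(t) · x`. -/
noncomputable def rsmul (t : ℝ) (x : H) : H := hmul (iemb t) x

theorem hadd_nonempty (x y : H) : (hadd x y).Nonempty := by
  rcases x with _ | ⟨_ | _ | _, a, ha⟩ <;> rcases y with _ | ⟨_ | _ | _, b, hb⟩ <;>
    simp only [hadd] <;> (try split_ifs) <;> simp

theorem image_hmul_hadd (σ : Sgn) (hσ : σ ≠ Sgn.lam) (c : ℝ) (hc : 0 < c) (x y : H) :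
    hmul (H.elt σ c hc) '' hadd x y = hadd (hmul (H.elt σ c hc) x) (hmul (H.elt σ c hc) y) := by
  have hlt (a b : ℝ) : c * a < c * b ↔ a < b := mul_lt_mul_iff_right₀ hc
  have heq (a b : ℝ) : c * a = c * b ↔ a = b := mul_right_inj' hc.ne'
  have habs (a b : ℝ) : |c * a - c * b| = c * |a - b| := by
    rw [← mul_sub, abs_mul, abs_of_pos hc]
  rcases σ with _ | _ | _
  on_goal 3 => exact absurd rfl hσ
  all_goals
    rcases x with _ | ⟨_ | _ | _, a, ha⟩ <;> rcases y with _ | ⟨_ | _ | _, b, hb⟩ <;>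
      simp only [hadd, hmul, smul, hlt, heq, habs] <;> (try split_ifs) <;>
      first
      | (exfalso; order)
      | simp [Set.image_insert_eq, hmul, smul, mul_add, mul_sub, mul_left_comm, Set.pair_comm]

theorem stmt_9 (t : ℝ) (x y : H) :
    rsmul t '' (hadd x y) = hadd (rsmul t x) (rsmul t y) := by
  rcases lt_trichotomy t 0 with ht | rfl | ht
  · have h : rsmul t = hmul (H.elt Sgn.neg (-t) (neg_pos.mpr ht)) := by
      funext z
      simp [rsmul, iemb, ht, ht.not_gt]
    rw [h, image_hmul_hadd _ (by decide)]
  · have h : rsmul 0 = fun _ => H.zero := by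
      funext z
      simp [rsmul, iemb, hmul]
    rw [h, (hadd_nonempty x y).image_const]
    simp [hadd]
  · have h : rsmul t = hmul (H.elt Sgn.pos t ht) := by
      funext z
      simp [rsmul, iemb, ht]
    rw [h, image_hmul_hadd _ (by decide)]
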